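/- (Recognition criterion for decomposable balanced complete intersections) Let 1 ≤ b ≤ n−1 and let I ⊆ S be a balanced complete intersection ideal of type (d)^n such that (A) the space of degree-d elements of I lying in the ideal (x_{b+1},…,x_n) has dimension exactly n−b over k (equivalently, the image of I in k[x_1,…,x_b] under setting x_{b+1} = … = x_n = 0 is a balanced complete intersection ideal of type (d)^b), and (B) (x_{b+1},…,x_n)^{(n−b)(d−1)+1} ⊆ I. Then there exist n−b linearly independent homogeneous forms of degree d lying in I ∩ k[x_{b+1},…,x_n]; in particular, I is decomposable. -/

import Mathlib

open MvPolynomial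

/-- A family `g : Fin n → k[x_1,…,x_n]` (spanning `U = ⟨g_1,…,g_n⟩`) is decomposable if
there exist a basis `y_1,…,y_n` of the linear forms, an integer `1 ≤ a ≤ n-1`, and a basis
`h_1,…,h_n` of `U` such that `h_{a+1},…,h_n ∈ k[y_{a+1},…,y_n]`. -/
def Decomposable {k : Type*} [Field k] {n : ℕ}
    (g : Fin n → MvPolynomial (Fin n) k) : Prop :=
  ∃ (y : Fin n → MvPolynomial (Fin n) k) (a : ℕ) (h : Fin n → MvPolynomial (Fin n) k),
    LinearIndependent k y ∧ (∀ i, (y i).IsHomogeneous 1) ∧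
    1 ≤ a ∧ a ≤ n - 1 ∧
    LinearIndependent k h ∧
    Submodule.span k (Set.range h) = Submodule.span k (Set.range g) ∧
    ∀ i : Fin n, a ≤ (i : ℕ) →
      h i ∈ Algebra.adjoin k {p | ∃ j : Fin n, a ≤ (j : ℕ) ∧ p = y j}

/-- Membership in `Q • ⊤` is tested on coordinates with respect to a basis. -/
theorem Module.Basis.mem_ideal_smul_top_iff {R M ι : Type*} [CommRing R] [AddCommGroup M]
    [Module R M] (b : Module.Basis ι R M) (Q : Ideal R) (x : M) :
    x ∈ Q • (⊤ : Submodule R M) ↔ ∀ t, b.repr x t ∈ Q := by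
  constructor
  · intro hx t
    refine Submodule.smul_induction_on hx (fun r hr m _ => ?_) (fun y z hy hz => ?_)
    · simpa using Q.mul_mem_right _ hr
    · simpa using Q.add_mem hy hz
  · intro h
    rw [← b.linearCombination_repr x, Finsupp.linearCombination_apply]
    exact Submodule.sum_mem _ fun t _ => Submodule.smul_mem_smul (h t) trivial

namespace ExteriorAlgebra

variable {R M : Type*} [CommRing R] [AddCommGroup M] [Module R M]

/-- Iterated contraction of an element of the exterior algebra by a list of linear forms. -/
noncomputable def contractList (L : List (Module.Dual R M)) (x : ExteriorAlgebra R M) :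
    ExteriorAlgebra R M :=
  L.foldr (fun l y => CliffordAlgebra.contractLeft l y) x

theorem ι_mul_contractList_cons (v : M) (x : ExteriorAlgebra R M) (l : Module.Dual R M)
    (L : List (Module.Dual R M)) :
    ι R v * contractList (l :: L) x =
      l v • contractList L x - CliffordAlgebra.contractLeft l (ι R v * contractList L x) := by
  have := CliffordAlgebra.contractLeft_ι_mul (Q := (0 : QuadraticForm R M)) (d := l) v
    (contractList L x)
  change CliffordAlgebra.contractLeft l (ι R v * contractList L x) =
    l v • contractList L x - ι R v * contractList (l :: L) x at this
  rw [this]; abel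

theorem contractLeft_mem_smul_top (l : Module.Dual R M) {Q : Ideal R} {y : ExteriorAlgebra R M}
    (hy : y ∈ Q • (⊤ : Submodule R (ExteriorAlgebra R M))) :
    CliffordAlgebra.contractLeft l y ∈ Q • (⊤ : Submodule R (ExteriorAlgebra R M)) := by
  have h1 := Submodule.mem_map_of_mem (f := CliffordAlgebra.contractLeft l) hy
  rw [Submodule.map_smul''] at h1
  exact Submodule.smul_mono le_rfl le_top h1

theorem ι_mul_contractList_mem (v : M) (x : ExteriorAlgebra R M) (hx : ι R v * x = 0)
    (L : List (Module.Dual R M)) :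
    ι R v * contractList L x ∈
      Ideal.ofList (L.map (· v)) • (⊤ : Submodule R (ExteriorAlgebra R M)) := by
  induction L with
  | nil => simp [contractList, hx]
  | cons l L ih =>
    rw [ι_mul_contractList_cons, List.map_cons, Ideal.ofList_cons]
    refine Submodule.sub_mem _ ?_ ?_
    · exact Submodule.smul_mem_smul (Ideal.mem_sup_left (Ideal.mem_span_singleton_self _)) trivial
    · exact Submodule.smul_mono le_sup_right le_rfl (contractLeft_mem_smul_top l ih)

theorem mem_range_of_contractList_mem {κ : Type*}
    (b : Module.Basis κ R (ExteriorAlgebra R M)) (v : M) (x : ExteriorAlgebra R M)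
    (hx : ι R v * x = 0) (L : List (Module.Dual R M))
    (hL : ∀ i (hi : i < L.length), ∀ r, L[i] v * r ∈ Ideal.ofList ((L.drop (i + 1)).map (· v)) →
      r ∈ Ideal.ofList ((L.drop (i + 1)).map (· v)))
    (h : contractList L x ∈ LinearMap.range (LinearMap.mulLeft R (ι R v)) ⊔
      Ideal.ofList (L.map (· v)) • (⊤ : Submodule R (ExteriorAlgebra R M))) :
    x ∈ LinearMap.range (LinearMap.mulLeft R (ι R v)) := by
  induction L with
  | nil => simpa [contractList] using h
  | cons l L ih =>
    apply ih (fun i hi => hL (i + 1) (by simpa using hi))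
    obtain ⟨y, ⟨z, rfl⟩, w, hw, hyw⟩ := Submodule.mem_sup.1 h
    rw [List.map_cons, Ideal.ofList_cons, Submodule.sup_smul] at hw
    obtain ⟨w₁, hw₁, w₂, hw₂, rfl⟩ := Submodule.mem_sup.1 hw
    rw [Submodule.ideal_span_singleton_smul, Submodule.mem_smul_pointwise_iff_exists] at hw₁
    obtain ⟨u, -, rfl⟩ := hw₁
    have hy := ι_mul_contractList_mem v x hx L
    have h2 : l v • (contractList L x - ι R v * u) =
        CliffordAlgebra.contractLeft l (ι R v * contractList L x) + ι R v * w₂ := by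
      have h3 := ι_mul_contractList_cons v x l L
      rw [← hyw, LinearMap.mulLeft_apply, mul_add, mul_add, ← mul_assoc, ι_sq_zero, zero_mul,
        zero_add, mul_smul_comm] at h3
      have h3' : CliffordAlgebra.contractLeft l (ι R v * contractList L x) =
          l v • contractList L x - (l v • (ι R v * u) + ι R v * w₂) := by rw [h3]; abel
      rw [smul_sub, h3']
      abel
    have h4 : ι R v * w₂ ∈ Ideal.ofList (L.map (· v)) • (⊤ : Submodule R (ExteriorAlgebra R M)) := by
      have h1 := Submodule.mem_map_of_mem (f := LinearMap.mulLeft R (ι R v)) hw₂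
      rw [Submodule.map_smul''] at h1
      exact Submodule.smul_mono le_rfl le_top h1
    have h5 : contractList L x - ι R v * u ∈
        Ideal.ofList (L.map (· v)) • (⊤ : Submodule R (ExteriorAlgebra R M)) := by
      have h6 := Submodule.add_mem _ (contractLeft_mem_smul_top l hy) h4
      rw [← h2, b.mem_ideal_smul_top_iff] at h6
      rw [b.mem_ideal_smul_top_iff]
      intro t
      exact hL 0 (by simp) _ (by simpa using h6 t)
    exact Submodule.mem_sup.2 ⟨_, ⟨u, rfl⟩, _, h5, by simp⟩

theorem contractList_ofFn {n : ℕ} {N : Type*} [AddCommGroup N] [Module R N]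
    (δ : N →ₗ[R] Module.Dual R M) (A : Fin n → N) (x : ExteriorAlgebra R M) :
    contractList (List.ofFn fun i => δ (A i)) x =
      lift R ⟨(CliffordAlgebra.contractLeft (Q := (0 : QuadraticForm R M))).comp δ,
        fun m => LinearMap.ext fun y => CliffordAlgebra.contractLeft_contractLeft (d := δ m) y⟩
        (ιMulti R n A) x := by
  rw [ιMulti_apply]
  induction n with
  | zero => simp [contractList]
  | succ n ih =>
    rw [List.ofFn_succ, List.ofFn_succ, List.prod_cons, map_mul, Module.End.mul_apply, ← ih,
      lift_ι_apply]
    rfl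

end ExteriorAlgebra

open ExteriorAlgebra in
/-- If `a = A f` with `a` a regular sequence, then `(a) : det A ⊆ (f)`. -/
theorem Matrix.mem_span_of_det_mul_mem {R : Type*} [CommRing R] {n : ℕ} (f a : Fin n → R)
    (A : Matrix (Fin n) (Fin n) R) (hA : A.mulVec f = a)
    (hreg : ∀ i r, a i * r ∈ Ideal.span (a '' Set.Ioi i) → r ∈ Ideal.span (a '' Set.Ioi i))
    {s : R} (hs : A.det * s ∈ Ideal.span (Set.range a)) : s ∈ Ideal.span (Set.range f) := by
  let b := (Pi.basisFun R (Fin n)).ExteriorAlgebra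
  let e : Fin n → Fin n → R := Pi.basisFun R (Fin n)
  let vol : ExteriorAlgebra R (Fin n → R) := ιMulti R n e
  let δ : (Fin n → R) →ₗ[R] Module.Dual R (Fin n → R) := dotProductBilin R R
  have hf : ι R f = ∑ i, f i • ι R (e i) := by
    conv_lhs => rw [← (Pi.basisFun R (Fin n)).sum_repr f]
    simp [e]
  have hvol : ι R f * (s • vol) = 0 := by
    rw [hf, Finset.sum_mul]
    refine Finset.sum_eq_zero fun i _ => ?_
    have h1 : ι R (e i) * vol = 0 := by
      have h2 : ιMulti R (n + 1) (Fin.cons (e i) e : Fin (n + 1) → Fin n → R) = 0 := by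
        apply ιMulti_eq_zero_of_not_inj
        intro hinj
        have := hinj (a₁ := 0) (a₂ := i.succ) (by simp)
        exact (Fin.succ_ne_zero i) this.symm
      rw [ιMulti_succ_apply] at h2
      simpa [vol, Matrix.vecTail, Function.comp_def] using h2
    rw [smul_mul_assoc, mul_smul_comm, h1, smul_zero, smul_zero]
  have hrow : ∀ i, δ (A i) f = a i := fun i => by rw [← hA]; rfl
  let L := List.ofFn fun i => δ (A i)
  have hLmap : L.map (· f) = List.ofFn a := by
    simp [L, List.map_ofFn, Function.comp_def, hrow]
  have hofList : Ideal.ofList (List.ofFn a) = Ideal.span (Set.range a) := by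
    rw [Ideal.ofList]; congr 1; ext; simp [List.mem_ofFn]
  have hdet : contractList L (s • vol) ∈
      Ideal.ofList (L.map (· f)) • (⊤ : Submodule R (ExteriorAlgebra R (Fin n → R))) := by
    rw [hLmap, hofList, b.mem_ideal_smul_top_iff]
    intro t
    rw [show contractList L (s • vol) = _ from contractList_ofFn δ A (s • vol)]
    let Φ := lift R ⟨(CliffordAlgebra.contractLeft (Q := (0 : QuadraticForm R (Fin n → R)))).comp δ,
        fun m => LinearMap.ext fun y => CliffordAlgebra.contractLeft_contractLeft (d := δ m) y⟩
    let F : (Fin n → R) [⋀^Fin n]→ₗ[R] R :=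
      ((b.coord t).comp ((LinearMap.applyₗ vol).comp Φ.toLinearMap)).compAlternatingMap (ιMulti R n)
    have h1 : F A = A.det * F e := by
      have := congrArg (fun G => G A) (F.eq_smul_basis_det (Pi.basisFun R (Fin n)))
      refine this.trans ?_
      rw [Pi.basisFun_det]
      exact mul_comm _ _
    have h2 : b.repr (Φ (ιMulti R n A) (s • vol)) t = (A.det * s) * F e := by
      have : b.repr (Φ (ιMulti R n A) (s • vol)) t = s * F A := by
        rw [map_smul, map_smul]; rfl
      rw [this, h1]; ring
    change b.repr (Φ (ιMulti R n A) (s • vol)) t ∈ _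
    rw [h2]
    exact Ideal.mul_mem_right _ _ hs
  obtain ⟨z, hz⟩ := mem_range_of_contractList_mem b f (s • vol) hvol L (by
    intro i hi r hr
    have hi' : i < n := by simpa [L] using hi
    have hQ : Ideal.ofList ((L.drop (i + 1)).map (· f)) =
        Ideal.span (a '' Set.Ioi ⟨i, hi'⟩) := by
      rw [List.map_drop, hLmap, Ideal.ofList]
      congr 1
      ext y
      simp only [Set.mem_ofPred_eq, List.mem_drop_iff_getElem, List.getElem_ofFn, Set.mem_image,
        Set.mem_Ioi, List.length_ofFn]
      constructor
      · rintro ⟨j, hj, rfl⟩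
        exact ⟨_, Fin.mk_lt_mk.2 (by omega), rfl⟩
      · rintro ⟨j, hj, rfl⟩
        refine ⟨j - (i + 1), ?_, ?_⟩
        · have := Fin.lt_def.1 hj
          simp only at this
          omega
        · congr 1
          ext
          have := Fin.lt_def.1 hj
          simp only at this ⊢
          omega
    rw [hQ] at hr ⊢
    refine hreg ⟨i, hi'⟩ r ?_
    simpa [L, hrow] using hr) (Submodule.mem_sup_right hdet)
  rw [LinearMap.mulLeft_apply] at hz
  let τ : ExteriorAlgebra R (Fin n → R) →ₗ[R] R :=
    liftAlternating (fun j => if h : j = n then h ▸ (Pi.basisFun R (Fin n)).det else 0)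
  have hτ : τ vol = 1 := by
    simp [τ, vol, liftAlternating_apply_ιMulti, e, -Pi.basisFun_det, Module.Basis.det_self]
  have h7 : s = τ (ι R f * z) := by rw [hz, map_smul, hτ, smul_eq_mul, mul_one]
  rw [h7, hf, Finset.sum_mul, map_sum]
  refine Ideal.sum_mem _ fun i _ => ?_
  rw [smul_mul_assoc, map_smul]
  exact Ideal.mul_mem_right _ _ (Ideal.subset_span ⟨i, rfl⟩)

/-- The homogeneous components of a product with a homogeneous polynomial. -/
theorem MvPolynomial.homogeneousComponent_mul_of_isHomogeneous {σ R : Type*} [CommSemiring R]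
    {f : MvPolynomial σ R} {e : ℕ} (hf : f.IsHomogeneous e) (c : MvPolynomial σ R) (m : ℕ) :
    homogeneousComponent m (c * f) = if e ≤ m then homogeneousComponent (m - e) c * f else 0 := by
  classical
  conv_lhs => rw [← sum_homogeneousComponent c, Finset.sum_mul, map_sum]
  have h1 : ∀ i, homogeneousComponent m (homogeneousComponent i c * f) =
      if m = i + e then homogeneousComponent i c * f else 0 := fun i =>
    homogeneousComponent_of_mem (((homogeneousComponent_isHomogeneous i c).mul hf))
  simp only [h1]
  split_ifs with hem
  · rw [Finset.sum_eq_single (m - e)]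
    · rw [if_pos (by omega)]
    · intro i _ hi
      rw [if_neg (by omega)]
    · intro h
      rw [homogeneousComponent_eq_zero _ _ (by rw [Finset.mem_range] at h; omega)]
      simp
  · exact Finset.sum_eq_zero fun i _ => if_neg (by omega)

/-- A form in an ideal generated by forms is a combination of them with homogeneous
coefficients. -/
theorem MvPolynomial.exists_isHomogeneous_coeffs {σ R ι : Type*} [CommRing R] [Fintype ι]
    {f : ι → MvPolynomial σ R} {e : ι → ℕ} (he : ∀ i, (f i).IsHomogeneous (e i))
    {p : MvPolynomial σ R} {m : ℕ} (hp : p.IsHomogeneous m)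
    (hpf : p ∈ Ideal.span (Set.range f)) :
    ∃ c : ι → MvPolynomial σ R, (∀ j, (c j).IsHomogeneous (m - e j)) ∧
      (∀ j, m < e j → c j = 0) ∧ ∑ j, c j * f j = p := by
  obtain ⟨c, hc⟩ := Ideal.mem_span_range_iff_exists_fun.1 hpf
  refine ⟨fun j => if e j ≤ m then homogeneousComponent (m - e j) (c j) else 0, fun j => ?_,
    fun j hj => if_neg (by omega), ?_⟩
  · dsimp only
    split_ifs
    · exact homogeneousComponent_isHomogeneous _ _
    · exact isHomogeneous_zero _ _ _
  · have h1 : homogeneousComponent m p = p := by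
      rw [homogeneousComponent_of_mem hp, if_pos rfl]
    rw [← h1, ← hc, map_sum]
    refine Finset.sum_congr rfl fun j _ => ?_
    rw [homogeneousComponent_mul_of_isHomogeneous (he j), ite_mul, zero_mul]

theorem MvPolynomial.mem_span_X_pow_image_iff {σ R : Type*} [CommSemiring R] {M : ℕ} {T : Set σ}
    {p : MvPolynomial σ R} :
    p ∈ Ideal.span ((fun i => (X i : MvPolynomial σ R) ^ M) '' T) ↔
      ∀ s ∈ p.support, ∃ i ∈ T, M ≤ s i := by
  have h : (fun i => (X i : MvPolynomial σ R) ^ M) '' T =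
      (fun s => monomial s (1 : R)) '' ((fun i => Finsupp.single i M) '' T) := by
    rw [Set.image_image]
    simp [X_pow_eq_monomial]
  rw [h, mem_ideal_span_monomial_image]
  simp

/-- The generators of an ideal primary to the irrelevant ideal that is generated by as many forms
as there are variables give a Gorenstein quotient: there is a linear functional inducing a perfect
pairing, concentrated in the socle degree. -/
theorem MvPolynomial.exists_dual_of_X_pow_mem {k : Type*} [Field k] {n : ℕ}
    (f : Fin n → MvPolynomial (Fin n) k) (e : Fin n → ℕ) (he : ∀ i, (f i).IsHomogeneous (e i))
    (hM : ∃ M, ∀ i, X i ^ M ∈ Ideal.span (Set.range f)) :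
    ∃ φ : MvPolynomial (Fin n) k →ₗ[k] k,
      (∀ p, p ∈ Ideal.span (Set.range f) ↔ ∀ q, φ (p * q) = 0) ∧
      ∀ p j, p.IsHomogeneous j → j + n ≠ ∑ i, e i → φ p = 0 := by
  obtain ⟨M₀, hM₀⟩ := hM
  let M := M₀ + ∑ i, e i + 1
  have heM : ∀ i, e i ≤ M := fun i => by
    have := Finset.single_le_sum (f := e) (fun _ _ => Nat.zero_le _) (Finset.mem_univ i)
    omega
  have hX : ∀ i, (X i : MvPolynomial (Fin n) k) ^ M ∈ Ideal.span (Set.range f) := fun i => by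
    have : (X i : MvPolynomial (Fin n) k) ^ M = X i ^ (∑ i, e i + 1) * X i ^ M₀ := by
      rw [← pow_add]; congr 1; omega
    rw [this]
    exact Ideal.mul_mem_left _ _ (hM₀ i)
  choose A hAhom _ hA using fun i =>
    exists_isHomogeneous_coeffs he (isHomogeneous_X_pow (R := k) i M) (hX i)
  let D := Matrix.det (Matrix.of A)
  have hAm : (Matrix.of A).mulVec f = fun i => X i ^ M := _root_.funext hA
  have hD : D.IsHomogeneous (∑ i, (M - e i)) := by
    rw [show D = _ from Matrix.det_apply' _]
    refine IsHomogeneous.sum _ _ _ fun π _ => ?_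
    have h1 := IsHomogeneous.prod Finset.univ (fun i => Matrix.of A (π i) i) (fun i => M - e i)
      (fun i _ => hAhom (π i) i)
    rcases Int.units_eq_one_or (Equiv.Perm.sign π) with h | h <;> rw [h]
    · simpa using h1
    · simpa using h1.neg
  have hDf : ∀ p ∈ Ideal.span (Set.range f), D * p ∈
      Ideal.span (Set.range fun i => (X i : MvPolynomial (Fin n) k) ^ M) := by
    intro p hp
    obtain ⟨c, rfl⟩ := Ideal.mem_span_range_iff_exists_fun.1 hp
    rw [Finset.mul_sum]
    refine Ideal.sum_mem _ fun i _ => ?_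
    have h1 : D * f i = ∑ j, (Matrix.of A).adjugate i j * X j ^ M := by
      have h2 : (Matrix.of A).adjugate.mulVec ((Matrix.of A).mulVec f) i = D * f i := by
        rw [Matrix.mulVec_mulVec, Matrix.adjugate_mul, Matrix.smul_mulVec, Matrix.one_mulVec]
        rfl
      rw [← h2, hAm]
      rfl
    rw [mul_left_comm, h1]
    exact Ideal.mul_mem_left _ _ (Ideal.sum_mem _ fun j _ =>
      Ideal.mul_mem_left _ _ (Ideal.subset_span ⟨j, rfl⟩))
  have hlink : ∀ p, D * p ∈ Ideal.span (Set.range fun i => (X i : MvPolynomial (Fin n) k) ^ M) →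
      p ∈ Ideal.span (Set.range f) := by
    intro p hp
    refine Matrix.mem_span_of_det_mul_mem f _ (Matrix.of A) hAm (fun i r hr => ?_) hp
    rw [mem_span_X_pow_image_iff] at hr ⊢
    intro s hs
    obtain ⟨j, hj, hjs⟩ := hr (Finsupp.single i M + s) (by
      rw [mem_support_iff, X_pow_eq_monomial, coeff_monomial_mul, one_mul]
      exact mem_support_iff.1 hs)
    refine ⟨j, hj, ?_⟩
    rwa [Finsupp.add_apply, Finsupp.single_eq_of_ne (ne_of_gt hj), zero_add] at hjs
  let t : Fin n →₀ ℕ := Finsupp.equivFunOnFinite.symm fun _ => M - 1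
  refine ⟨(lcoeff k t).comp (LinearMap.mulLeft k D), fun p => ⟨fun hp q => ?_, fun h => ?_⟩,
    fun p j hp hj => ?_⟩
  · have h1 := hDf (p * q) (Ideal.mul_mem_right _ _ hp)
    rw [← Set.image_univ, mem_span_X_pow_image_iff] at h1
    by_contra h2
    obtain ⟨i, -, hi⟩ := h1 t (mem_support_iff.2 h2)
    simp only [t, Finsupp.equivFunOnFinite_symm_apply_apply] at hi
    omega
  · by_contra hp
    have h1 := mt (hlink p) hp
    rw [← Set.image_univ, mem_span_X_pow_image_iff] at h1
    push Not at h1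
    obtain ⟨s, hs, hsM⟩ := h1
    have h2 := h (monomial (t - s) 1)
    apply mem_support_iff.1 hs
    have h3 : t = s + (t - s) := by
      ext i
      have := hsM i trivial
      simp only [t, Finsupp.add_apply, Finsupp.tsub_apply,
        Finsupp.equivFunOnFinite_symm_apply_apply]
      omega
    have h4 : coeff t (D * (p * monomial (t - s) 1)) = 0 := h2
    rw [← mul_assoc, h3] at h4
    rw [add_tsub_cancel_left, coeff_mul_monomial, mul_one] at h4
    exact h4
  · by_contra h
    have h1 : (D * p).IsHomogeneous (∑ i, (M - e i) + j) := hD.mul hp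
    have h2 := h1 (d := t) h
    have h3 : Finsupp.weight 1 t = n * (M - 1) := by
      rw [Finsupp.weight_eq_sum]
      simp [t]
    rw [h3] at h2
    apply hj
    have h4 : ∑ i, (M - e i) + ∑ i, e i = n * M := by
      rw [← Finset.sum_add_distrib, Finset.sum_congr rfl fun i _ => Nat.sub_add_cancel (heM i)]
      simp
    have h5 : n * M = n * (M - 1) + n := by
      rw [← Nat.mul_succ]; congr 1
    omega

theorem Module.supportDim_add_length_le_of_isWeaklyRegular {R : Type*} [CommRing R]
    [IsNoetherianRing R] {M : Type*} [AddCommGroup M] [Module R M] [Module.Finite R M]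
    (rs : List R) (h : RingTheory.Sequence.IsWeaklyRegular M rs) :
    supportDim R (M ⧸ Ideal.ofList rs • (⊤ : Submodule R M)) + rs.length ≤ supportDim R M := by
  induction rs generalizing M with
  | nil =>
    rw [Ideal.ofList_nil, Submodule.bot_smul]
    simpa using (supportDim_eq_of_equiv (Submodule.quotEquivOfEqBot ⊥ rfl)).le
  | cons x rs' ih =>
    obtain ⟨h1, h2⟩ := (RingTheory.Sequence.isWeaklyRegular_cons_iff M _ _).mp h
    have h3 := supportDim_quotSMulTop_succ_le_of_notMem_minimalPrimes
      (fun _ ↦ h1.notMem_of_mem_minimalPrimes)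
    refine le_trans ?_ h3
    rw [supportDim_eq_of_equiv (Submodule.quotOfListConsSMulTopEquivQuotSMulTopInner M x _)]
    have h4 := ih h2
    simp only [List.length_cons, Nat.cast_add, Nat.cast_one, ← add_assoc]
    gcongr

theorem Ideal.ofList_ofFn {R : Type*} [CommSemiring R] {n : ℕ} (g : Fin n → R) :
    Ideal.ofList (List.ofFn g) = Ideal.span (Set.range g) := by
  rw [Ideal.ofList]
  congr 1
  ext x
  simp [List.mem_ofFn]

theorem MvPolynomial.finite_quotient_of_isRegular {k : Type*} [Field k] {n : ℕ}
    {g : Fin n → MvPolynomial (Fin n) k}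
    (hreg : RingTheory.Sequence.IsRegular (MvPolynomial (Fin n) k) (List.ofFn g)) :
    Module.Finite k (MvPolynomial (Fin n) k ⧸ Ideal.span (Set.range g)) := by
  have h1 := Module.supportDim_add_length_le_of_isWeaklyRegular _ hreg.toIsWeaklyRegular
  have h0 : Ideal.ofList (List.ofFn g) • (⊤ : Submodule (MvPolynomial (Fin n) k) _) =
    Ideal.span (Set.range g) := by rw [Ideal.ofList_ofFn]; simp
  rw [h0, Module.supportDim_quotient_eq_ringKrullDim, Module.supportDim_self_eq_ringKrullDim,
    MvPolynomial.ringKrullDim_of_isNoetherianRing, ringKrullDim_eq_zero_of_field, zero_add,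
    List.length_ofFn, Nat.card_fin] at h1
  have h2 : ringKrullDim (MvPolynomial (Fin n) k ⧸ Ideal.span (Set.range g)) ≤ 0 := by
    generalize ringKrullDim (MvPolynomial (Fin n) k ⧸ Ideal.span (Set.range g)) = a at h1
    induction a with
    | bot => exact bot_le
    | coe a =>
      induction a with
      | top => exact absurd h1 (of_decide_eq_false rfl)
      | coe a => 
        norm_cast at h1 ⊢
        have : a + n ≤ n := by exact_mod_cast h1
        omega
  have h3 : IsArtinianRing (MvPolynomial (Fin n) k ⧸ Ideal.span (Set.range g)) := by
    rw [isArtinianRing_iff_krullDimLE_zero, Ring.krullDimLE_iff]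
    exact_mod_cast h2
  exact Module.finite_of_isArtinianRing k _

theorem MvPolynomial.linearIndependent_of_isRegular {k : Type*} [Field k] {n m : ℕ}
    {g : Fin n → MvPolynomial (Fin m) k}
    (hreg : RingTheory.Sequence.IsRegular (MvPolynomial (Fin m) k) (List.ofFn g)) :
    LinearIndependent k g := by
  classical
  rw [Fintype.linearIndependent_iff]
  by_contra! h
  obtain ⟨c, hc, i₀, hi₀⟩ := h
  obtain ⟨i, hi, hmax⟩ := (Finset.univ.filter fun i => c i ≠ 0).exists_max_image id
    ⟨i₀, by simpa using hi₀⟩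
  replace hi : c i ≠ 0 := by simpa using hi
  have hle : ∀ j, i < j → c j = 0 := fun j hj => by
    by_contra h
    exact absurd (hmax j (by simpa using h)) (not_le.2 hj)
  have htake : ∀ j < i, g j ∈ Ideal.ofList ((List.ofFn g).take i) := fun j hj =>
    Ideal.subset_span <| by
      change g j ∈ List.take i (List.ofFn g)
      rw [List.mem_take_iff_getElem]
      exact ⟨j, by simpa using hj, by simp⟩
  have hgi : g i ∈ Ideal.ofList ((List.ofFn g).take i) := by
    have h1 : g i = (c i)⁻¹ • -∑ j ∈ Finset.univ.erase i, c j • g j := by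
      rw [← Finset.add_sum_erase _ _ (Finset.mem_univ i)] at hc
      rw [← eq_neg_of_add_eq_zero_left hc, smul_smul, inv_mul_cancel₀ hi, one_smul]
    rw [h1]
    refine Submodule.smul_of_tower_mem _ _ (neg_mem (sum_mem fun j hj => ?_))
    rcases lt_or_gt_of_ne (Finset.ne_of_mem_erase hj) with h | h
    · exact Submodule.smul_of_tower_mem _ _ (htake j h)
    · rw [hle j h, zero_smul]
      exact zero_mem _
  have hone : (1 : MvPolynomial (Fin m) k) ∈ Ideal.ofList ((List.ofFn g).take i) := by
    have h1 := hreg.regular_mod_prev i (by simp)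
    have h2 := @h1 (Submodule.Quotient.mk 1) 0
    simp only [List.getElem_ofFn, smul_zero, ← Submodule.Quotient.mk_smul,
      Submodule.Quotient.mk_eq_zero, smul_eq_mul, mul_one, Ideal.mul_top] at h2
    exact h2 hgi
  apply hreg.top_ne_smul
  rw [smul_eq_mul, Ideal.mul_top, eq_comm, Ideal.eq_top_iff_one]
  refine Ideal.span_mono (fun x hx => ?_) hone
  exact List.mem_of_mem_take hx

theorem MvPolynomial.exists_X_pow_mem_of_finite_quotient {k : Type*} [Field k] {n : ℕ}
    {I : Ideal (MvPolynomial (Fin n) k)}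
    (hI : ∀ p ∈ I, ∀ m, homogeneousComponent m p ∈ I)
    [Module.Finite k (MvPolynomial (Fin n) k ⧸ I)] :
    ∃ M, ∀ i, X i ^ M ∈ I := by
  have h1 : ∀ i : Fin n, ∃ M, X i ^ M ∈ I := by
    intro i
    obtain ⟨p, hp, hpi⟩ := Algebra.IsIntegral.isIntegral (R := k)
      (Ideal.Quotient.mk I (X i))
    refine ⟨p.natDegree, ?_⟩
    have h2 : p.aeval (X i) ∈ I := by
      rw [← Ideal.Quotient.eq_zero_iff_mem, ← hpi, ← Ideal.Quotient.mkₐ_eq_mk k,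
        ← Polynomial.aeval_algHom_apply]
      rfl
    have h3 := hI _ h2 p.natDegree
    have h4 : homogeneousComponent p.natDegree (p.aeval (X i : MvPolynomial (Fin n) k)) =
        X i ^ p.natDegree := by
      rw [Polynomial.aeval_eq_sum_range, map_sum, Finset.sum_eq_single p.natDegree]
      · rw [hp.coeff_natDegree, one_smul, homogeneousComponent_of_mem
          (isHomogeneous_X_pow i _), if_pos rfl]
      · intro j _ hj
        rw [map_smul, homogeneousComponent_of_mem (isHomogeneous_X_pow i _), if_neg hj.symm,
          smul_zero]
      · simp
    rwa [h4] at h3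
  choose M hM using h1
  refine ⟨∑ i, M i, fun i => ?_⟩
  obtain ⟨c, hc⟩ := Nat.exists_eq_add_of_le
    (Finset.single_le_sum (f := M) (fun _ _ => Nat.zero_le _) (Finset.mem_univ i))
  rw [hc, pow_add]
  exact Ideal.mul_mem_right _ _ (hM i)

theorem MvPolynomial.homogeneousComponent_mem_span {σ R ι : Type*} [CommRing R] [Fintype ι]
    {f : ι → MvPolynomial σ R} {e : ι → ℕ} (he : ∀ i, (f i).IsHomogeneous (e i))
    {p : MvPolynomial σ R} (hp : p ∈ Ideal.span (Set.range f)) (m : ℕ) :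
    homogeneousComponent m p ∈ Ideal.span (Set.range f) := by
  obtain ⟨c, rfl⟩ := Ideal.mem_span_range_iff_exists_fun.1 hp
  rw [map_sum]
  refine sum_mem fun j _ => ?_
  rw [homogeneousComponent_mul_of_isHomogeneous (he j)]
  split_ifs
  · exact Ideal.mul_mem_left _ _ (Ideal.subset_span ⟨j, rfl⟩)
  · exact zero_mem _

theorem exists_linearIndependent_of_le_span {K E : Type*} [Field K] [AddCommGroup E] [Module K E]
    {n b : ℕ} (hb : b ≤ n) {g : Fin n → E} (hg : LinearIndependent K g) {V : Submodule K E}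
    (hV : V ≤ Submodule.span K (Set.range g)) (hVb : Module.finrank K V = n - b) :
    ∃ h : Fin n → E, LinearIndependent K h ∧
      Submodule.span K (Set.range h) = Submodule.span K (Set.range g) ∧
      ∀ i : Fin n, b ≤ (i : ℕ) → h i ∈ V := by
  set U := Submodule.span K (Set.range g) with hU
  have : Module.Finite K U := Module.Finite.span_of_finite K (Set.finite_range g)
  have hUn : Module.finrank K U = n := by
    rw [hU, finrank_span_eq_card hg, Fintype.card_fin]
  obtain ⟨W, hW⟩ := (V.submoduleOf U).exists_isCompl
  have hV' : Module.finrank K (V.submoduleOf U) = n - b := by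
    rw [(Submodule.submoduleOfEquivOfLe hV).finrank_eq, hVb]
  have hW' : Module.finrank K W = b := by
    have := Submodule.finrank_add_eq_of_isCompl hW
    omega
  let B := (((Module.finBasisOfFinrankEq K W hW').prod
    (Module.finBasisOfFinrankEq K (V.submoduleOf U) hV')).map
      (Submodule.prodEquivOfIsCompl _ _ hW.symm)).reindex
      (finSumFinEquiv.trans (finCongr (Nat.add_sub_cancel' hb)))
  refine ⟨fun i => B i, ?_, ?_, fun i hi => ?_⟩
  · exact B.linearIndependent.map' U.subtype U.ker_subtype
  · have h1 : (Set.range fun i => (B i : E)) = U.subtype '' Set.range B := by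
      rw [← Set.range_comp]; rfl
    rw [h1, ← Submodule.map_span, B.span_eq, Submodule.map_top, Submodule.range_subtype]
  · obtain ⟨j, rfl⟩ : ∃ j : Fin (n - b),
        i = (finSumFinEquiv.trans (finCongr (Nat.add_sub_cancel' hb))) (Sum.inr j) :=
      ⟨⟨i - b, by omega⟩, by ext; simp; omega⟩
    simp only [B, Module.Basis.reindex_apply, Equiv.symm_apply_apply]
    rw [Module.Basis.map_apply, Module.Basis.prod_apply, Sum.elim_inr, Function.comp_apply,
      LinearMap.inr_apply, Submodule.coe_prodEquivOfIsCompl', Submodule.coe_zero, zero_add]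
    exact ((Module.finBasisOfFinrankEq K (V.submoduleOf U) hV') j).2

theorem Ideal.mul_mem_of_mem_sup {R : Type*} [CommRing R] {I J : Ideal R} {f p : R}
    (hf : ∀ x ∈ J, f * x ∈ I) (hp : p ∈ I ⊔ J) : f * p ∈ I := by
  obtain ⟨x, hx, y, hy, rfl⟩ := Submodule.mem_sup.1 hp
  rw [mul_add]
  exact add_mem (Ideal.mul_mem_left _ _ hx) (hf y hy)

namespace MvPolynomial

variable {σ k : Type*} [Field k]

theorem linearMap_apply_eq_of_isHomogeneous {E : Type*} [AddCommGroup E] [Module k E]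
    {L L' : MvPolynomial σ k →ₗ[k] E} (h : ∀ i p, p.IsHomogeneous i → L p = L' p)
    (p : MvPolynomial σ k) : L p = L' p := by
  rw [← sum_homogeneousComponent p, map_sum, map_sum]
  exact Finset.sum_congr rfl fun i _ => h i _ (homogeneousComponent_isHomogeneous i p)

section Dual

variable {φ ψ : MvPolynomial σ k →ₗ[k] k} {I J : Ideal (MvPolynomial σ k)} {N τ : ℕ}

theorem mem_of_isHomogeneous_of_dual
    (hψ : ∀ p, p ∈ I ↔ ∀ q, ψ (p * q) = 0) (hψd : ∀ p j, p.IsHomogeneous j → j ≠ τ → ψ p = 0)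
    {p : MvPolynomial σ k} {j : ℕ} (hp : p.IsHomogeneous j) (hj : τ ≤ j) (h0 : ψ p = 0) :
    p ∈ I := by
  rw [hψ]
  refine linearMap_apply_eq_of_isHomogeneous (L := ψ.comp (LinearMap.mulLeft k p)) (L' := 0)
    fun i q hq => ?_
  change ψ (p * q) = 0
  by_cases hi : i = 0
  · subst hi
    rw [← totalDegree_zero_iff_isHomogeneous, totalDegree_eq_zero_iff_eq_C] at hq
    rw [hq, mul_comm, C_mul', map_smul, h0, smul_zero]
  · exact hψd _ _ (hp.mul hq) (by omega)

/-- Let `φ` and `ψ` be dual functionals of `I` and `I ⊔ J`, with socle degrees `N + τ` and `τ`.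
A form of degree less than `N` that multiplies `J` into `I` lies in `I`. -/
theorem mem_of_mul_mem_of_dual
    (hφ : ∀ p, p ∈ I ↔ ∀ q, φ (p * q) = 0)
    (hφd : ∀ p j, p.IsHomogeneous j → j ≠ N + τ → φ p = 0)
    (hψ : ∀ p, p ∈ I ⊔ J ↔ ∀ q, ψ (p * q) = 0)
    (hψd : ∀ p j, p.IsHomogeneous j → j ≠ τ → ψ p = 0)
    {f : MvPolynomial σ k} {e : ℕ} (hf : f.IsHomogeneous e)
    (he : e < N) (hfJ : ∀ x ∈ J, f * x ∈ I) : f ∈ I := by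
  rw [hφ]
  refine linearMap_apply_eq_of_isHomogeneous (L := φ.comp (LinearMap.mulLeft k f)) (L' := 0)
    fun i q hq => ?_
  change φ (f * q) = 0
  by_cases hi : e + i = N + τ
  · have h1 : f * q ∈ I := Ideal.mul_mem_of_mem_sup hfJ
      (mem_of_isHomogeneous_of_dual hψ hψd hq (by omega) (hψd _ _ hq (by omega)))
    simpa using (hφ _).1 h1 1
  · exact hφd _ _ (hf.mul hq) hi

/-- A form `f` of degree `N` that multiplies `J` into `I` pairs with `r` under `φ` as a multiple of
`ψ r`. -/
theorem apply_mul_eq_of_dual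
    (hφ : ∀ p, p ∈ I ↔ ∀ q, φ (p * q) = 0)
    (hφd : ∀ p j, p.IsHomogeneous j → j ≠ N + τ → φ p = 0)
    (hψ : ∀ p, p ∈ I ⊔ J ↔ ∀ q, ψ (p * q) = 0)
    (hψd : ∀ p j, p.IsHomogeneous j → j ≠ τ → ψ p = 0)
    {f : MvPolynomial σ k} (hf : f.IsHomogeneous N)
    (hfJ : ∀ x ∈ J, f * x ∈ I) {r₀ : MvPolynomial σ k} (hr₀ : r₀.IsHomogeneous τ)
    (hr₀1 : ψ r₀ = 1) (r : MvPolynomial σ k) : φ (f * r) = φ (f * r₀) * ψ r := by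
  refine linearMap_apply_eq_of_isHomogeneous (L := φ.comp (LinearMap.mulLeft k f))
    (L' := φ (f * r₀) • ψ) (fun i q hq => ?_) r
  change φ (f * q) = φ (f * r₀) * ψ q
  by_cases hi : i = τ
  · subst hi
    have h1 : f * (q - ψ q • r₀) ∈ I := Ideal.mul_mem_of_mem_sup hfJ
      (mem_of_isHomogeneous_of_dual hψ hψd
        (hq.sub ((homogeneousSubmodule σ k i).smul_mem _ hr₀)) le_rfl (by simp [hr₀1]))
    have h2 := (hφ _).1 h1 1
    rw [mul_one, mul_sub, mul_smul_comm, map_sub, map_smul, sub_eq_zero] at h2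
    rw [h2, smul_eq_mul, mul_comm]
  · rw [hφd _ _ (hf.mul hq) (by omega), hψd _ _ hq hi, mul_zero]

theorem monomial_mem_span_X_pow (Z : σ → Prop) [DecidablePred Z] (s : σ →₀ ℕ) (c : k) :
    monomial s c ∈ (Ideal.span (X '' {i | Z i}) : Ideal (MvPolynomial σ k)) ^
      (s.filter Z).degree := by
  induction s using Finsupp.induction generalizing c with
  | zero => simp [Finsupp.filter_zero]
  | single_add i m s hi hm ih =>
    rw [← one_mul c, ← monomial_mul, Finsupp.filter_add, map_add, pow_add]
    refine Ideal.mul_mem_mul ?_ (ih c)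
    by_cases hZ : Z i
    · rw [Finsupp.filter_single_of_pos _ hZ, Finsupp.degree_single, ← X_pow_eq_monomial]
      exact Ideal.pow_mem_pow
        (Ideal.subset_span (Set.mem_image_of_mem X (show i ∈ {i | Z i} from hZ))) _
    · rw [Finsupp.filter_single_of_neg _ hZ]
      simp

theorem mem_of_forall_mul_monomial_mem
    (hφ : ∀ p, p ∈ I ↔ ∀ q, φ (p * q) = 0)
    (hφd : ∀ p j, p.IsHomogeneous j → j ≠ N + τ → φ p = 0)
    (hψ : ∀ p, p ∈ I ⊔ J ↔ ∀ q, ψ (p * q) = 0)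
    (hψd : ∀ p j, p.IsHomogeneous j → j ≠ τ → ψ p = 0)
    (Z : σ → Prop) [DecidablePred Z]
    (hJ : J = Ideal.span (X '' {i | Z i})) (c : ℕ) {f : MvPolynomial σ k} {m : ℕ}
    (hf : f.IsHomogeneous m) (hm : m + c = N)
    (h : ∀ u : σ →₀ ℕ, u.filter Z = u → u.degree = c → f * monomial u 1 ∈ I) : f ∈ I := by
  induction c generalizing f m with
  | zero => simpa using h 0 (Finsupp.filter_zero _) (by simp)
  | succ c ih =>
    refine mem_of_mul_mem_of_dual hφ hφd hψ hψd hf (by omega) fun x hx => ?_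
    have h1 : J ≤ Submodule.comap (LinearMap.mulLeft (MvPolynomial σ k) f) I := by
      rw [hJ, Ideal.span_le]
      rintro _ ⟨i, hi, rfl⟩
      change f * X i ∈ I
      refine ih (hf.mul (isHomogeneous_X k i)) (by omega) fun u hu huc => ?_
      rw [mul_assoc, X, monomial_mul, one_mul]
      refine h _ ?_ ?_
      · rw [Finsupp.filter_add, hu, Finsupp.filter_single_of_pos _ (show Z i from hi)]
      · rw [map_add, huc, Finsupp.degree_single, add_comm]
    exact h1 hx

theorem exists_isHomogeneous_apply_eq_one (hψ : ∀ p, p ∈ I ↔ ∀ q, ψ (p * q) = 0)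
    (hψd : ∀ p j, p.IsHomogeneous j → j ≠ τ → ψ p = 0) (hI : I ≠ ⊤) :
    ∃ r, r.IsHomogeneous τ ∧ ψ r = 1 := by
  rw [Ne, Ideal.eq_top_iff_one, hψ] at hI
  by_contra! h
  refine hI fun q => ?_
  rw [one_mul]
  refine linearMap_apply_eq_of_isHomogeneous (L' := 0) (fun i p hp => ?_) q
  by_contra hp0
  have hp0 : ψ p ≠ 0 := hp0
  obtain rfl : i = τ := by_contra fun hi => hp0 (hψd p i hp hi)
  refine h ((ψ p)⁻¹ • p) ((homogeneousSubmodule σ k i).smul_mem _ hp) ?_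
  rw [map_smul, smul_eq_mul, inv_mul_cancel₀ hp0]

/-- If `J` is generated by the variables satisfying `Z` and `J ^ (N + 1) ≤ I`, then every form of
degree `d` in `I ⊓ J`, where `d` is the initial degree of `I`, involves only these variables. -/
theorem degree_filter_eq_of_dual
    (hφ : ∀ p, p ∈ I ↔ ∀ q, φ (p * q) = 0)
    (hφd : ∀ p j, p.IsHomogeneous j → j ≠ N + τ → φ p = 0)
    (hψ : ∀ p, p ∈ I ⊔ J ↔ ∀ q, ψ (p * q) = 0)
    (hψd : ∀ p j, p.IsHomogeneous j → j ≠ τ → ψ p = 0)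
    (Z : σ → Prop) [DecidablePred Z]
    (hJ : J = Ideal.span (X '' {i | Z i})) (hJN : J ^ (N + 1) ≤ I) (hIJ : I ⊔ J ≠ ⊤)
    {d : ℕ} (hdN : d ≤ N + 1)
    (hI : ∀ p m, p.IsHomogeneous m → m < d → p ∈ I → p = 0)
    (hK : ∀ p m, p.IsHomogeneous m → m < d → p ∈ I ⊔ J → p ∈ J)
    {h : MvPolynomial σ k} (hh : h.IsHomogeneous d) (hhI : h ∈ I) (hhJ : h ∈ J)
    {s : σ →₀ ℕ} (hs : s ∈ h.support) : (s.filter Z).degree = d := by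
  classical
  have hsum : ∀ s : σ →₀ ℕ, (s.filter Z).degree + (s.filter (¬ Z ·)).degree = s.degree := by
    intro s
    rw [← map_add, Finsupp.filter_add_filter_not]
  have hdeg : ∀ s ∈ h.support, s.degree = d := fun s hs => by
    rw [Finsupp.degree_eq_weight_one]
    exact hh (mem_support_iff.1 hs)
  obtain ⟨r₀, hr₀, hr₀1⟩ := exists_isHomogeneous_apply_eq_one hψ hψd hIJ
  suffices H : ∀ m < d, ∀ s ∈ h.support, (s.filter Z).degree ≠ m by
    have h1 : ¬ (s.filter Z).degree < d := fun h1 => H _ h1 s hs rfl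
    have h2 := hsum s
    rw [hdeg s hs] at h2
    omega
  intro m
  induction m using Nat.strong_induction_on with
  | _ m ih =>
  intro hmd s hs hsm
  by_cases hm0 : m = 0
  · subst hm0
    rw [hJ, mem_ideal_span_X_image] at hhJ
    obtain ⟨i, hi, hsi⟩ := hhJ s hs
    rw [Finsupp.degree_eq_zero_iff] at hsm
    have := DFunLike.congr_fun hsm i
    rw [Finsupp.filter_apply_pos _ _ (show Z i from hi)] at this
    exact hsi this
  let A := h.support.filter fun s => (s.filter Z).degree = m
  have hA : ∀ s ∈ A, s ∈ h.support ∧ (s.filter Z).degree = m := fun s hs => Finset.mem_filter.1 hs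
  let B := A.filter fun t => t.filter (¬ Z ·) = s.filter (¬ Z ·)
  let P : MvPolynomial σ k := ∑ t ∈ B, monomial (t.filter Z) (coeff t h)
  have hP : P.IsHomogeneous m := IsHomogeneous.sum _ _ _ fun t ht =>
    isHomogeneous_monomial _ (hA t (Finset.mem_filter.1 ht).1).2
  have hPI : P ∈ I := by
    refine mem_of_forall_mul_monomial_mem hφ hφd hψ hψd Z hJ (N - m) hP (by omega)
      fun u hu hum => ?_
    have hJmul : ∀ {f : MvPolynomial σ k}, f ∈ J ^ N → ∀ x ∈ J, f * x ∈ I := fun hf x hx =>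
      hJN (by rw [pow_succ]; exact Ideal.mul_mem_mul hf hx)
    have humem : ∀ t : σ →₀ ℕ, ∀ c : k, (t.filter Z).degree = m →
        monomial (t.filter Z + u) c ∈ J ^ N := fun t c ht => by
      have h1 := monomial_mem_span_X_pow Z (t.filter Z + u) c
      have h2 : (t.filter Z).filter Z = t.filter Z := by
        rw [Finsupp.filter_eq_self_iff]
        intro i hi
        by_contra h
        exact hi (Finsupp.filter_apply_neg _ _ h)
      rw [Finsupp.filter_add, hu, h2, map_add, hum] at h1
      rwa [ht, Nat.add_sub_cancel' (by omega), ← hJ] at h1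
    let a : (σ →₀ ℕ) → k := fun t => φ (monomial (t.filter Z + u) (coeff t h) * r₀)
    let T : MvPolynomial σ k := ∑ t ∈ A, monomial (t.filter (¬ Z ·)) (a t)
    have hT : T.IsHomogeneous (d - m) := IsHomogeneous.sum _ _ _ fun t ht =>
      isHomogeneous_monomial _ (by
        have h1 := hsum t
        rw [hdeg t (hA t ht).1, (hA t ht).2] at h1
        omega)
    let hm : MvPolynomial σ k := ∑ t ∈ A, monomial t (coeff t h)
    have hmI : hm * monomial u 1 ∈ I := by
      have h1 : hm = h - ∑ t ∈ h.support.filter fun s => (s.filter Z).degree ≠ m,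
          monomial t (coeff t h) := by
        rw [eq_sub_iff_add_eq, Finset.sum_filter_add_sum_filter_not]
        exact (as_sum h).symm
      rw [h1, sub_mul]
      refine sub_mem (Ideal.mul_mem_right _ _ hhI) ?_
      rw [Finset.sum_mul]
      refine sum_mem fun t ht => hJN ?_
      obtain ⟨ht1, ht2⟩ := Finset.mem_filter.1 ht
      have h2 : m < (t.filter Z).degree := by
        by_contra h
        exact ih (t.filter Z).degree (by omega) (by omega) t ht1 rfl
      rw [monomial_mul]
      have h3 := monomial_mem_span_X_pow Z (t + u) (coeff t h * 1)
      rw [← hJ, Finsupp.filter_add, hu, map_add] at h3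
      exact Ideal.pow_le_pow_right (by omega) h3
    have hTK : T ∈ I ⊔ J := by
      rw [hψ]
      intro r
      have h1 := (hφ _).1 hmI r
      rw [← h1]
      simp only [T, hm, Finset.sum_mul, map_sum]
      refine Finset.sum_congr rfl fun t ht => ?_
      have h2 : monomial (t.filter (¬ Z ·)) (a t) = a t • monomial (t.filter (¬ Z ·)) (1 : k) := by
        rw [smul_monomial, smul_eq_mul, mul_one]
      rw [h2, smul_mul_assoc, map_smul, smul_eq_mul,
        ← apply_mul_eq_of_dual hφ hφd hψ hψd (isHomogeneous_monomial _ ?_)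
          (hJmul (humem t (coeff t h) (hA t ht).2)) hr₀ hr₀1, ← mul_assoc, monomial_mul,
        monomial_mul, add_right_comm, Finsupp.filter_add_filter_not]
      rw [map_add, (hA t ht).2, hum, Nat.add_sub_cancel' (by omega)]
    have hTJ := hK T _ hT (by omega) hTK
    have hTs : coeff (s.filter (¬ Z ·)) T = 0 := by
      by_contra h
      rw [hJ, mem_ideal_span_X_image] at hTJ
      obtain ⟨i, hi, hsi⟩ := hTJ _ (mem_support_iff.2 h)
      exact hsi (Finsupp.filter_apply_neg _ _ (not_not.2 hi))
    have hTB : coeff (s.filter (¬ Z ·)) T = φ (P * monomial u 1 * r₀) := by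
      simp only [T, coeff_sum, coeff_monomial, P, Finset.sum_mul, map_sum, monomial_mul, mul_one]
      rw [← Finset.sum_filter]
    rw [hφ]
    intro r
    rw [apply_mul_eq_of_dual hφ hφd hψ hψd (N := N) ?_ (hJmul ?_) hr₀ hr₀1, ← hTB, hTs, zero_mul]
    · convert! hP.mul (isHomogeneous_monomial (1 : k) hum) using 1
      omega
    · rw [Finset.sum_mul]
      refine sum_mem fun t ht => ?_
      rw [monomial_mul]
      exact humem t _ (hA t (Finset.mem_filter.1 ht).1).2
  have hP0 := hI P m hP hmd hPI
  have hcoeff : coeff (s.filter Z) P = coeff s h := by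
    simp only [P, coeff_sum, coeff_monomial]
    rw [Finset.sum_eq_single s]
    · simp
    · intro t ht hts
      rw [if_neg]
      intro h
      apply hts
      rw [← Finsupp.filter_add_filter_not t Z, h, (Finset.mem_filter.1 ht).2,
        Finsupp.filter_add_filter_not]
    · intro h
      exact absurd (show s ∈ B from Finset.mem_filter.2 ⟨Finset.mem_filter.2 ⟨hs, hsm⟩, rfl⟩) h
  rw [hP0, coeff_zero] at hcoeff
  exact mem_support_iff.1 hs hcoeff.symm

end Dual

theorem eq_zero_of_isHomogeneous_of_mem_span {σ R ι : Type*} [CommRing R] [Fintype ι]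
    {f : ι → MvPolynomial σ R} {e : ι → ℕ} (he : ∀ i, (f i).IsHomogeneous (e i))
    {p : MvPolynomial σ R} {m : ℕ} (hp : p.IsHomogeneous m) (hm : ∀ i, m < e i)
    (hpf : p ∈ Ideal.span (Set.range f)) : p = 0 := by
  obtain ⟨c, -, hc0, rfl⟩ := exists_isHomogeneous_coeffs he hp hpf
  exact Finset.sum_eq_zero fun j _ => by rw [hc0 j (hm j), zero_mul]

theorem mem_span_of_isHomogeneous_of_mem_ideal_span {σ R ι : Type*} [CommRing R] [Fintype ι]
    {f : ι → MvPolynomial σ R} {d : ℕ} (hf : ∀ i, (f i).IsHomogeneous d)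
    {p : MvPolynomial σ R} (hp : p.IsHomogeneous d) (hpf : p ∈ Ideal.span (Set.range f)) :
    p ∈ Submodule.span R (Set.range f) := by
  obtain ⟨c, hc, -, rfl⟩ := exists_isHomogeneous_coeffs hf hp hpf
  refine sum_mem fun j _ => ?_
  have h1 := hc j
  rw [Nat.sub_self, ← totalDegree_zero_iff_isHomogeneous, totalDegree_eq_zero_iff_eq_C] at h1
  rw [h1, C_mul']
  exact Submodule.smul_mem _ _ (Submodule.subset_span ⟨j, rfl⟩)

theorem mem_supported_of_degree_filter_eq {σ R : Type*} [CommSemiring R] (Z : σ → Prop)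
    [DecidablePred Z] {p : MvPolynomial σ R} {d : ℕ} (hp : p.IsHomogeneous d)
    (h : ∀ s ∈ p.support, (s.filter Z).degree = d) : p ∈ supported R {i | Z i} := by
  rw [mem_supported]
  intro i hi
  obtain ⟨s, hs, his⟩ := (mem_vars_iff_mem_support i).1 (Finset.mem_coe.1 hi)
  by_contra hZ
  have h1 : s.degree = d := by
    rw [Finsupp.degree_eq_weight_one]
    exact hp (mem_support_iff.1 hs)
  have h2 : (s.filter Z).degree + (s.filter (¬ Z ·)).degree = s.degree := by
    rw [← map_add, Finsupp.filter_add_filter_not]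
  rw [h s hs, h1, Nat.add_eq_left, Finsupp.degree_eq_zero_iff] at h2
  have h3 := DFunLike.congr_fun h2 i
  rw [Finsupp.filter_apply_pos (¬ Z ·) _ (show ¬ Z i from hZ)] at h3
  exact Finsupp.mem_support_iff.1 his h3

end MvPolynomial

theorem Fin.sum_ite_le_one (b c d : ℕ) :
    ∑ i : Fin (b + c), (if b ≤ (i : ℕ) then 1 else d) = b * d + c := by
  have h (i : Fin b) : ¬ b ≤ (i : ℕ) := not_le.2 i.2
  simp [Fin.sum_univ_add, h]

theorem Ideal.span_le_of_submodule_span_le {k A : Type*} [CommSemiring k] [CommSemiring A]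
    [Algebra k A] {s t : Set A} (h : Submodule.span k s ≤ Submodule.span k t) :
    Ideal.span s ≤ Ideal.span t :=
  Ideal.span_le.2 fun _ hx => Submodule.span_subset_span k A t (h (Submodule.subset_span hx))

/-- Recognition criterion for decomposable balanced complete intersections: if
`I = (g_1,…,g_n)` is a balanced complete intersection of type `(d)^n` such that
(A) `dim_k (I_d ∩ (x_{b+1},…,x_n)) = n - b` and (B) `(x_{b+1},…,x_n)^{(n-b)(d-1)+1} ⊆ I`,
then there are `n - b` linearly independent degree-`d` forms in `I ∩ k[x_{b+1},…,x_n]`;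
in particular, `I` is decomposable. -/
theorem stmt6 {k : Type*} [Field k] {n d b : ℕ} (hb1 : 1 ≤ b) (hb2 : b ≤ n - 1)
    (g : Fin n → MvPolynomial (Fin n) k)
    (hhom : ∀ i, (g i).IsHomogeneous d)
    (hreg : RingTheory.Sequence.IsRegular (MvPolynomial (Fin n) k) (List.ofFn g))
    (hA : Module.finrank k
      ↥(Submodule.restrictScalars k (Ideal.span (Set.range g)) ⊓
        Submodule.restrictScalars k
          (Ideal.span {p : MvPolynomial (Fin n) k | ∃ j : Fin n, b ≤ (j : ℕ) ∧ p = X j}) ⊓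
        homogeneousSubmodule (Fin n) k d) = n - b)
    (hB : (Ideal.span {p : MvPolynomial (Fin n) k | ∃ j : Fin n, b ≤ (j : ℕ) ∧ p = X j}) ^
        ((n - b) * (d - 1) + 1) ≤ Ideal.span (Set.range g)) :
    (∃ h : Fin (n - b) → MvPolynomial (Fin n) k,
      LinearIndependent k h ∧
      ∀ j, (h j).IsHomogeneous d ∧ h j ∈ Ideal.span (Set.range g) ∧
        h j ∈ MvPolynomial.supported k {i : Fin n | b ≤ (i : ℕ)}) ∧
    Decomposable g := by
  have hset : {p : MvPolynomial (Fin n) k | ∃ j : Fin n, b ≤ (j : ℕ) ∧ p = X j} =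
      X '' {i : Fin n | b ≤ (i : ℕ)} := by
    ext p
    simp [eq_comm]
  set I := Ideal.span (Set.range g) with hI
  rw [hset] at hA hB
  set J : Ideal (MvPolynomial (Fin n) k) := Ideal.span (X '' {i : Fin n | b ≤ (i : ℕ)}) with hJ
  set V := Submodule.restrictScalars k I ⊓ Submodule.restrictScalars k J ⊓
    homogeneousSubmodule (Fin n) k d with hV
  have hlin := linearIndependent_of_isRegular hreg
  have hItop : I ≠ ⊤ := by
    intro h
    apply hreg.top_ne_smul
    rw [Ideal.ofList_ofFn, ← hI, h]
    simp
  have hd : 1 ≤ d := by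
    by_contra hd
    obtain rfl : d = 0 := by omega
    let i : Fin n := ⟨0, by omega⟩
    have h1 := hhom i
    rw [← totalDegree_zero_iff_isHomogeneous, totalDegree_eq_zero_iff_eq_C] at h1
    have h2 : coeff 0 (g i) ≠ 0 := fun h => hlin.ne_zero i (by rw [h1, h, C_0])
    refine hItop (Ideal.eq_top_of_isUnit_mem _ (Ideal.subset_span ⟨i, rfl⟩) ?_)
    rw [h1]
    exact (isUnit_iff_ne_zero.2 h2).map C
  obtain ⟨M, hM⟩ : ∃ M, ∀ i, X i ^ M ∈ I := by
    have := finite_quotient_of_isRegular hreg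
    exact exists_X_pow_mem_of_finite_quotient fun p hp m => homogeneousComponent_mem_span hhom hp m
  obtain ⟨h, hhlin, hhspan, hhV⟩ := exists_linearIndependent_of_le_span (b := b) (by omega) hlin
    (V := V) (fun p hp => mem_span_of_isHomogeneous_of_mem_ideal_span hhom hp.2 hp.1.1) hA
  have hhd : ∀ i, (h i).IsHomogeneous d := by
    have h1 : Submodule.span k (Set.range g) ≤ homogeneousSubmodule (Fin n) k d :=
      Submodule.span_le.2 (Set.range_subset_iff.2 hhom)
    intro i
    exact h1 (hhspan ▸ Submodule.subset_span ⟨i, rfl⟩)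
  have hhI : Ideal.span (Set.range h) = I :=
    le_antisymm (Ideal.span_le_of_submodule_span_le hhspan.le)
      (Ideal.span_le_of_submodule_span_le hhspan.ge)
  let f : Fin n → MvPolynomial (Fin n) k := fun i => if b ≤ (i : ℕ) then X i else h i
  let e : Fin n → ℕ := fun i => if b ≤ (i : ℕ) then 1 else d
  have hfe : ∀ i, (f i).IsHomogeneous (e i) := fun i => by
    simp only [f, e]
    split_ifs
    · exact isHomogeneous_X k i
    · exact hhd i
  have hfJ : ∀ i : Fin n, b ≤ (i : ℕ) → f i ∈ J := fun i hi => by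
    simp only [f, if_pos hi]
    exact Ideal.subset_span ⟨i, hi, rfl⟩
  have hfK : Ideal.span (Set.range f) = I ⊔ J := by
    refine le_antisymm (Ideal.span_le.2 ?_) (sup_le ?_ (Ideal.span_le.2 ?_))
    · rintro _ ⟨i, rfl⟩
      by_cases hi : b ≤ (i : ℕ)
      · exact Ideal.mem_sup_right (hfJ i hi)
      · simp only [f, if_neg hi]
        exact Ideal.mem_sup_left (hhI ▸ Ideal.subset_span ⟨i, rfl⟩)
    · rw [← hhI, Ideal.span_le]
      rintro _ ⟨i, rfl⟩
      by_cases hi : b ≤ (i : ℕ)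
      · refine (Ideal.span_le.2 ?_ : J ≤ _) (hhV i hi).1.2
        rintro _ ⟨j, hj, rfl⟩
        exact Ideal.subset_span ⟨j, if_pos hj⟩
      · exact Ideal.subset_span ⟨i, if_neg hi⟩
    · rintro _ ⟨i, hi, rfl⟩
      exact Ideal.subset_span ⟨i, if_pos hi⟩
  obtain ⟨φ, hφ, hφd⟩ := exists_dual_of_X_pow_mem g (fun _ => d) hhom ⟨M, hM⟩
  obtain ⟨ψ, hψ, hψd⟩ := exists_dual_of_X_pow_mem f e hfe
    ⟨M, fun i => hfK ▸ Ideal.mem_sup_left (hM i)⟩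
  have he : ∑ i, e i = b * d + (n - b) := by
    obtain ⟨c, rfl⟩ := Nat.exists_eq_add_of_le (show b ≤ n by omega)
    rw [Fin.sum_ite_le_one, Nat.add_sub_cancel_left]
  obtain ⟨d', rfl⟩ := Nat.exists_eq_add_of_le' hd
  rw [Nat.add_sub_cancel] at hB
  have hVsupp : ∀ p ∈ V, p ∈ supported k {i : Fin n | b ≤ (i : ℕ)} := by
    intro p hp
    refine mem_supported_of_degree_filter_eq _ hp.2 fun s hs =>
      degree_filter_eq_of_dual (φ := φ) (ψ := ψ) (I := I) (J := J) (N := (n - b) * d')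
        (τ := b * d') hφ (fun q j hq hj => hφd q j hq ?_) (hfK ▸ hψ)
        (fun q j hq hj => hψd q j hq ?_) _ hJ hB ?_ ?_ ?_ ?_ hp.2 hp.1.1 hp.1.2 hs
    · simp only [Finset.sum_const, Finset.card_univ, Fintype.card_fin, smul_eq_mul]
      obtain ⟨c, rfl⟩ := Nat.exists_eq_add_of_le (show b ≤ n by omega)
      rw [Nat.add_sub_cancel_left] at hj
      have : (b + c) * (d' + 1) = c * d' + b * d' + (b + c) := by ring
      omega
    · rw [he, mul_add]
      omega
    · rw [← hfK, Ne, Ideal.eq_top_iff_one]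
      intro h1
      refine one_ne_zero (eq_zero_of_isHomogeneous_of_mem_span hfe (isHomogeneous_one _ _)
        (fun i => ?_) h1)
      simp only [e]
      split_ifs <;> omega
    · exact Nat.succ_le_succ (Nat.le_mul_of_pos_left _ (by omega))
    · intro q m hq hm hqI
      exact eq_zero_of_isHomogeneous_of_mem_span hhom hq (fun _ => hm) hqI
    · intro q m hq hm hqK
      rw [← hfK] at hqK
      obtain ⟨c, -, hc0, rfl⟩ := exists_isHomogeneous_coeffs hfe hq hqK
      refine sum_mem fun i _ => ?_
      by_cases hi : b ≤ (i : ℕ)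
      · exact Ideal.mul_mem_left _ _ (hfJ i hi)
      · rw [hc0 i (by simpa only [e, if_neg hi] using hm), zero_mul]
        exact zero_mem _
  refine ⟨⟨fun j => h ⟨b + j, by omega⟩, hhlin.comp _ fun i j hij => ?_, fun j => ⟨hhd _, ?_, ?_⟩⟩,
    X, b, h, ?_, isHomogeneous_X k, hb1, hb2, hhlin, hhspan, fun i hi => ?_⟩
  · ext
    simpa using hij
  · exact (hhV _ (Nat.le_add_right _ _)).1.1
  · exact hVsupp _ (hhV _ (Nat.le_add_right _ _))
  · exact linearIndependent_X (Fin n) k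
  · rw [hset]
    exact hVsupp _ (hhV i hi)
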